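/- Let R be a one-dimensional Noetherian local domain over a field of characteristic zero, essentially of finite type. If Der_k(R) is a free R-module, then R is regular. -/

import Mathlib

open IsLocalRing

/-- A Noetherian local ring is regular if its embedding dimension (the dimension of the
cotangent space over the residue field) equals its Krull dimension. -/
def IsRegularLocal (R : Type*) [CommRing R] [IsLocalRing R] : Prop :=
  (Module.finrank (ResidueField R) (CotangentSpace R) : WithBot (WithTop ℕ)) =
    ringKrullDim R

theorem Derivation.exists_extension_of_isLocalization {k S T N : Type*} [CommRing k] [CommRing S]
    [CommRing T] [Algebra k S] [Algebra k T] [Algebra S T] [IsScalarTower k S T] (M : Submonoid S)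
    [IsLocalization M T] [AddCommGroup N] [Module k N] [Module S N] [Module T N]
    [IsScalarTower S T N] [IsScalarTower k S N] [IsScalarTower k T N] (d : Derivation k S N) :
    ∃ d' : Derivation k T N, ∀ s, d' (algebraMap S T s) = d s := by
  have hN : ∀ x : M, IsUnit (algebraMap S (Module.End S N) x) := fun x => by
    have := (IsLocalization.map_units T x).map (algebraMap T (Module.End T N))
    rw [Module.End.isUnit_iff] at this ⊢
    convert! this using 1
    ext n
    simp
  let g : Ω[T⁄k] →ₗ[S] N :=
    IsLocalizedModule.lift M (KaehlerDifferential.map k k S T) d.liftKaehlerDifferential hN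
  let g' : Ω[T⁄k] →ₗ[T] N := g.extendScalarsOfIsLocalization M T
  refine ⟨g'.compDer (KaehlerDifferential.D k T), fun s => ?_⟩
  have := LinearMap.congr_fun (IsLocalizedModule.lift_comp M (KaehlerDifferential.map k k S T)
    d.liftKaehlerDifferential hN) (KaehlerDifferential.D k S s)
  simpa [g', g] using this

open Polynomial in
/-- Iterating a derivation `n` times on `a (X - b) ^ n` and evaluating at `b`. -/
theorem Derivation.iterate_mapCoeffs_eval {A : Type*} [CommRing A]
    (δ : Derivation ℤ A[X] A[X]) (e : A) (b c : A) (hδ : δ (X - C b) = C e)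
    (n : ℕ) : ∀ j ≤ n, ∃ q : A[X], δ^[j] (C c * (X - C b) ^ n) =
      C ((n.descFactorial j : A) * c * e ^ j) * (X - C b) ^ (n - j) +
        (X - C b) ^ (n - j + 1) * q := by
  intro j
  induction j with
  | zero => intro _; exact ⟨0, by simp⟩
  | succ j ih =>
    intro hj
    obtain ⟨q, hq⟩ := ih (by omega)
    obtain ⟨m, hm⟩ : ∃ m, n - j = m + 1 := ⟨n - j - 1, by omega⟩
    have hm' : n - (j + 1) = m := by omega
    rw [Function.iterate_succ_apply', hq, hm, hm', Nat.descFactorial_succ, hm]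
    refine ⟨δ (C ((n.descFactorial j : A) * c * e ^ j)) + (X - C b) * δ q +
      ((m : A[X]) + 2) * C e * q, ?_⟩
    simp only [map_add, Derivation.leibniz, Derivation.leibniz_pow, hδ, smul_eq_mul, nsmul_eq_mul,
      Nat.add_sub_cancel, map_mul, map_pow]
    push_cast
    simp only [C_add, C_mul, C_1, _root_.map_natCast]
    ring

open Polynomial in
theorem Derivation.map_mem_integralClosure {k R K : Type*} [Field k] [CharZero k] [CommRing R]
    [IsDomain R] [IsNoetherianRing R] [Algebra k R] [Field K] [Algebra R K] [IsFractionRing R K]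
    [Algebra k K] [IsScalarTower k R K] (d : Derivation k K K)
    (hd : ∀ x : R, d (algebraMap R K x) ∈ (algebraMap R K).range) {b : K}
    (hb : IsIntegral R b) : IsIntegral R (d b) := by
  obtain ⟨r, hr, h⟩ := hb.isAlmostIntegral
  refine IsAlmostIntegral.isIntegral ⟨r * r, mul_mem hr hr, fun n => ?_⟩
  let dZ : Derivation ℤ K K := d.restrictScalars ℤ
  let : Differential K := ⟨dZ⟩
  let δ : Derivation ℤ K[X] K[X] := Differential.mapCoeffs
  have hδ (p : K[X]) (i : ℕ) : (δ p).coeff i = d (p.coeff i) := rfl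
  have hX : δ (X - C b) = C (-d b) := by
    ext i
    rw [hδ, coeff_sub, coeff_X, coeff_C, coeff_C]
    split_ifs <;> simp_all
  set p : K[X] := C (algebraMap R K r) * (X - C b) ^ n with hp
  obtain ⟨q, hq⟩ := Derivation.iterate_mapCoeffs_eval δ (-d b) b (algebraMap R K r) hX n n le_rfl
  have hcoeff : ∀ j i, (δ^[j] p).coeff i ∈ (algebraMap R K).range := by
    intro j
    induction j with
    | zero =>
      intro i
      simp only [Function.iterate_zero, id, hp, sub_eq_add_neg, ← C_neg, coeff_C_mul,
        coeff_X_add_C_pow]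
      obtain ⟨y, hy⟩ := h (n - i)
      refine ⟨y * ((-1) ^ (n - i) * (n.choose i : R)), ?_⟩
      rw [map_mul, hy, Algebra.smul_def, neg_pow b]
      simp
      ring
    | succ j ih =>
      intro i
      rw [Function.iterate_succ_apply', hδ]
      obtain ⟨x, hx⟩ := ih i
      exact hx ▸ hd x
  have heval := congr(eval b $hq)
  simp only [Nat.sub_self, pow_zero, eval_add, eval_mul, eval_C, Nat.descFactorial_self] at heval
  simp only [zero_add, pow_one, eval_sub, eval_X, eval_C, sub_self, zero_mul, eval_one,
    mul_one, add_zero] at heval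
  have hmem : algebraMap R K r * eval b (δ^[n] p) ∈ (algebraMap R K).range := by
    rw [eval_eq_sum_range, Finset.mul_sum]
    refine sum_mem fun i _ => ?_
    have := mul_mem (hcoeff n i) (h i)
    rw [Algebra.smul_def] at this
    convert this using 1
    ring
  rw [hp, heval] at hmem
  have hn : (n.factorial : k) ≠ 0 := by exact_mod_cast n.factorial_ne_zero
  have hu : algebraMap R K (algebraMap k R ((-1) ^ n * (n.factorial : k)⁻¹)) ∈
    (algebraMap R K).range := ⟨_, rfl⟩
  convert mul_mem hu hmem using 1
  rw [← IsScalarTower.algebraMap_apply, Algebra.smul_def]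
  simp only [map_mul, map_inv₀, _root_.map_natCast, map_pow, map_neg, map_one]
  have hn' : (n.factorial : K) ≠ 0 := by
    rw [← _root_.map_natCast (algebraMap k K)]; exact (_root_.map_ne_zero _).mpr hn
  rw [neg_pow (d b)]
  field_simp
  rw [← pow_mul, mul_comm n 2, pow_mul]
  simp

theorem Module.Finite.integralClosure_of_finiteType {k A K : Type*} [Field k] [CharZero k]
    [CommRing A] [IsDomain A] [Algebra k A] [Algebra.FiniteType k A] [Field K] [Algebra A K]
    [IsFractionRing A K] : Module.Finite A (integralClosure A K) := by
  obtain ⟨s, g, hg, hgfin⟩ := exists_finite_inj_algHom_of_fg k A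
  let P := MvPolynomial (Fin s) k
  let : Algebra P A := g.toRingHom.toAlgebra
  let : Algebra P K := ((algebraMap A K).comp g.toRingHom).toAlgebra
  have : IsScalarTower P A K := .of_algebraMap_eq' rfl
  have : Module.Finite P A := hgfin
  have hPK : Function.Injective (algebraMap P K) := (IsFractionRing.injective A K).comp hg
  have : FaithfulSMul P K := (faithfulSMul_iff_algebraMap_injective P K).mpr hPK
  let : Algebra (FractionRing P) K := FractionRing.liftAlgebra P K
  have : IsScalarTower P (FractionRing P) K := inferInstance
  have : Algebra.IsAlgebraic A K := IsFractionRing.comap_isAlgebraic_iff (K := K).mpr inferInstance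
  have : Algebra.IsAlgebraic P K := Algebra.IsAlgebraic.trans P A K
  have : Algebra.IsAlgebraic (FractionRing P) K :=
    (IsFractionRing.comap_isAlgebraic_iff (A := P)).mp this
  have : Algebra.EssFiniteType P A := inferInstance
  have : Algebra.EssFiniteType A K := .of_isLocalization K (nonZeroDivisors A)
  have : Algebra.EssFiniteType P K := .comp P A K
  have : Algebra.EssFiniteType (FractionRing P) K := .of_comp P _ K
  have : FiniteDimensional (FractionRing P) K := Algebra.finite_of_essFiniteType_of_isAlgebraic
  have : CharZero P := inferInstanceAs (CharZero (MvPolynomial (Fin s) k))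
  have : IsIntegrallyClosed P := inferInstance
  have : IsIntegralClosure (integralClosure A K) P K :=
    { algebraMap_injective := Subtype.val_injective
      isIntegral_iff := fun {x} => ⟨fun hx => ⟨⟨x, hx.tower_top⟩, rfl⟩, by
        rintro ⟨y, rfl⟩
        exact isIntegral_trans _ y.2⟩ }
  have := IsIntegralClosure.finite P (FractionRing P) K (integralClosure A K)
  exact .of_restrictScalars_finite P _ _

theorem IsFractionRing.of_isLocalization_of_faithfulSMul {A K : Type*} [CommRing A] [IsDomain A]
    (M : Submonoid A) (R : Type*) [CommRing R] [IsDomain R] [Algebra A R] [IsLocalization M R]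
    [FaithfulSMul A R] [Field K] [Algebra A K] [Algebra R K] [IsScalarTower A R K]
    [IsFractionRing R K] : IsFractionRing A K := by
  have : FaithfulSMul A K := (faithfulSMul_iff_algebraMap_injective A K).mpr <| by
    rw [IsScalarTower.algebraMap_eq A R K]
    exact (IsFractionRing.injective R K).comp (FaithfulSMul.algebraMap_injective A R)
  refine IsFractionRing.of_field A K fun z => ?_
  obtain ⟨x, y, -, rfl⟩ := IsFractionRing.div_surjective (A := R) z
  obtain ⟨⟨a, m⟩, ha⟩ := IsLocalization.surj M x
  obtain ⟨⟨b, n⟩, hb⟩ := IsLocalization.surj M y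
  have hm := ((IsLocalization.map_units R m).map (algebraMap R K)).ne_zero
  have hn := ((IsLocalization.map_units R n).map (algebraMap R K)).ne_zero
  refine ⟨a * n, b * m, ?_⟩
  simp only [map_mul, IsScalarTower.algebraMap_apply A R K]
  simp only at ha hb
  rw [← ha, ← hb, map_mul, map_mul]
  field_simp

theorem Module.Finite.integralClosure_of_essFiniteType (k : Type*) {R K : Type*} [Field k]
    [CharZero k] [CommRing R] [IsDomain R] [Algebra k R] [Algebra.EssFiniteType k R] [Field K]
    [Algebra R K] [IsFractionRing R K] : Module.Finite R (integralClosure R K) := by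
  let A := Algebra.EssFiniteType.subalgebra k R
  let M := Algebra.EssFiniteType.submonoid k R
  have : IsLocalization M R := Algebra.EssFiniteType.isLocalization k R
  have : FaithfulSMul A R := (faithfulSMul_iff_algebraMap_injective A R).mpr Subtype.val_injective
  have : IsFractionRing A K := .of_isLocalization_of_faithfulSMul M R
  have hfin : Module.Finite A (integralClosure A K) := .integralClosure_of_finiteType (k := k)
  let φ : integralClosure A K →ₗ[A] integralClosure R K :=
    { toFun := fun x => ⟨x, x.2.tower_top⟩
      map_add' := fun _ _ => rfl
      map_smul' := fun _ _ => rfl }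
  have hfg : (LinearMap.range φ).FG := by
    rw [LinearMap.range_eq_map]
    exact hfin.fg_top.map φ
  obtain ⟨S, hS⟩ := hfg
  refine ⟨S, eq_top_iff.mpr fun x _ => ?_⟩
  obtain ⟨m, hm⟩ := x.2.exists_multiple_integral_of_isLocalization M
  have hmx : (m : A) • x ∈ Submodule.span A (S : Set (integralClosure R K)) := by
    rw [hS]
    exact ⟨⟨_, hm⟩, rfl⟩
  have hmx' := Submodule.span_le_restrictScalars A R _ hmx
  obtain ⟨u, hu⟩ := IsLocalization.map_units R m
  have hx : x = (↑u⁻¹ : R) • ((m : A) • x) := by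
    rw [← algebraMap_smul R (m : A) x, ← hu, smul_smul, Units.inv_mul, one_smul]
  rw [hx]
  exact Submodule.smul_mem _ _ hmx'

open Polynomial in
/-- A local algebra over a field contains a field over which its residue field is algebraic. -/
theorem IsLocalRing.exists_subalgebra_isField_residueField_isAlgebraic (k V : Type*) [Field k]
    [CommRing V] [IsLocalRing V] [Algebra k V] :
    ∃ L : Subalgebra k V, IsField L ∧
      ∀ x : V, ∃ f : L[X], f ≠ 0 ∧ aeval x f ∈ maximalIdeal V := by
  obtain ⟨s, hs⟩ := exists_isTranscendenceBasis k (ResidueField V)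
  choose y hy using fun i : s => residue_surjective (R := V) i
  let P := MvPolynomial s k
  let φ : P →ₐ[k] V := MvPolynomial.aeval y
  have hφ (p : P) : residue V (φ p) = MvPolynomial.aeval ((↑) : s → ResidueField V) p := by
    have : ((IsScalarTower.toAlgHom k V (ResidueField V)).comp φ) =
        MvPolynomial.aeval ((↑) : s → ResidueField V) := by
      ext i
      simpa [φ] using hy i
    exact DFunLike.congr_fun this p
  have hunit (p : nonZeroDivisors P) : IsUnit (φ p) := by
    rw [← residue_ne_zero_iff_isUnit, hφ, Ne, map_eq_zero_iff _ hs.1]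
    exact nonZeroDivisors.ne_zero p.2
  let ψ : FractionRing P →ₐ[k] V := IsLocalization.liftAlgHom (M := nonZeroDivisors P) hunit
  have hψ (p : P) : ψ (algebraMap P _ p) = φ p := by simp [ψ]
  have hψinj : Function.Injective ψ := ψ.toRingHom.injective
  refine ⟨ψ.range, (AlgEquiv.ofInjective ψ hψinj).symm.toMulEquiv.isField (Field.toIsField _),
    fun x => ?_⟩
  let : Algebra P (ResidueField V) := ((residue V).comp φ.toRingHom).toAlgebra
  have := hs.isAlgebraic
  have : Algebra.IsAlgebraic P (ResidueField V) := by
    refine Algebra.IsAlgebraic.of_ringHom_of_comp_eq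
      hs.1.aevalEquiv.toRingEquiv.toRingHom (RingHom.id (ResidueField V))
      hs.1.aevalEquiv.surjective Function.injective_id ?_
    refine RingHom.ext fun p => ?_
    exact (hs.1.algebraMap_aevalEquiv p).trans (hφ p).symm
  obtain ⟨p, hp0, hp⟩ := Algebra.IsAlgebraic.isAlgebraic (R := P) (residue V x)
  let ι : P →+* ψ.range := ψ.rangeRestrict.toRingHom.comp (algebraMap P (FractionRing P))
  have hι : Function.Injective ι :=
    ((AlgEquiv.ofInjective ψ hψinj).injective).comp (IsFractionRing.injective P _)
  refine ⟨p.map ι, (Polynomial.map_ne_zero_iff hι).mpr hp0, ?_⟩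
  rw [← residue_eq_zero_iff, aeval_def, hom_eval₂, eval₂_map, ← hp, aeval_def]
  congr 1
  refine RingHom.ext fun q => ?_
  exact congr(residue V $(hψ q))

open Polynomial in
theorem IsDiscreteValuationRing.span_kaehlerDifferential_eq_top {L V : Type*} [Field L] [CharZero L]
    [CommRing V] [IsDomain V] [IsDiscreteValuationRing V] [Algebra L V] [Algebra.EssFiniteType L V]
    (h : ∀ x : V, ∃ f : L[X], f ≠ 0 ∧ aeval x f ∈ IsLocalRing.maximalIdeal V) {t : V}
    (ht : Irreducible t) :
    Submodule.span V {KaehlerDifferential.D L V t} = ⊤ := by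
  set N := Submodule.span V {KaehlerDifferential.D L V t}
  let I := IsLocalRing.maximalIdeal V
  refine top_le_iff.mp (Submodule.le_of_le_smul_of_le_jacobson_bot (I := I) Module.Finite.fg_top
    (maximalIdeal_le_jacobson _) ?_)
  let Q := N ⊔ I • (⊤ : Submodule V (Ω[V⁄L]))
  let d : Derivation L V (_ ⧸ Q) := Q.mkQ.compDer (KaehlerDifferential.D L V)
  have hsmul (a : V) (ha : a ∈ I) (q : _ ⧸ Q) : a • q = 0 := by
    obtain ⟨q, rfl⟩ := Q.mkQ_surjective q
    rw [← map_smul, Submodule.mkQ_apply, Submodule.Quotient.mk_eq_zero]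
    exact Submodule.mem_sup_right (Submodule.smul_mem_smul ha Submodule.mem_top)
  have hdI (a : V) (ha : a ∈ I) : d a = 0 := by
    obtain ⟨b, rfl⟩ := Ideal.mem_span_singleton'.mp (ht.maximalIdeal_eq.le ha)
    have hdt : d t = 0 := (Submodule.Quotient.mk_eq_zero _).mpr
      (Submodule.mem_sup_left (Submodule.mem_span_singleton_self _))
    rw [d.leibniz, hdt, smul_zero, zero_add,
      hsmul t ((mem_maximalIdeal t).mpr ht.not_isUnit)]
  have hd (x : V) : d x = 0 := by
    obtain ⟨f, hf, hfx⟩ := h x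
    have hres (p : L[X]) : residue V (aeval x p) = aeval (residue V x) p :=
      (aeval_algebraMap_apply (ResidueField V) x p).symm
    have hx : IsIntegral L (residue V x) := IsAlgebraic.isIntegral
      ⟨f, hf, by rw [← hres, residue_eq_zero_iff]; exact hfx⟩
    have h1 := hdI (aeval x (minpoly L (residue V x))) <| by
      rw [← residue_eq_zero_iff, hres, minpoly.aeval]
    have h2 : IsUnit (aeval x (derivative (minpoly L (residue V x)))) := by
      rw [← residue_ne_zero_iff_isUnit, hres]
      exact (minpoly.irreducible hx).separable.aeval_derivative_ne_zero (minpoly.aeval _ _)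
    rw [d.map_aeval] at h1
    exact h2.smul_eq_zero.mp h1
  refine (KaehlerDifferential.span_range_derivation L V).ge.trans (Submodule.span_le.mpr ?_)
  rintro _ ⟨x, rfl⟩
  exact (Submodule.Quotient.mk_eq_zero Q).mp (hd x)

theorem IsDiscreteValuationRing.smul_D_ne_zero {L V : Type*} [Field L] [CommRing V]
    [IsDomain V] [IsDiscreteValuationRing V] [Algebra L V] [Algebra.EssFiniteType L V] {t : V}
    (ht : Irreducible t) (hspan : Submodule.span V {KaehlerDifferential.D L V t} = ⊤) {r : V}
    (hr : r ≠ 0) : r • KaehlerDifferential.D L V t ≠ 0 := by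
  intro h
  let K := FractionRing V
  have hzero (x : V) : KaehlerDifferential.map L L V K (KaehlerDifferential.D L V x) = 0 := by
    obtain ⟨c, hc⟩ := Submodule.mem_span_singleton.mp
      (hspan ▸ Submodule.mem_top : KaehlerDifferential.D L V x ∈ _)
    have hrx : r • KaehlerDifferential.D L V x = 0 := by
      rw [← hc, smul_comm, h, smul_zero]
    have := congr(KaehlerDifferential.map L L V K $hrx)
    rw [map_smul, map_zero, ← algebraMap_smul K r] at this
    exact (smul_eq_zero.mp this).resolve_left
      ((map_ne_zero_iff _ (IsFractionRing.injective V K)).mpr hr)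
  have hsub : Subsingleton (Ω[K⁄L]) := by
    have := KaehlerDifferential.span_range_map_derivation_of_isLocalization L V K
      (nonZeroDivisors V)
    rw [← Submodule.subsingleton_iff K, ← subsingleton_iff_bot_eq_top, ← this, eq_comm,
      Submodule.span_eq_bot]
    rintro _ ⟨x, rfl⟩
    exact hzero x
  have := (Algebra.formallyUnramified_iff L K).mpr hsub
  have : Algebra.EssFiniteType L K := .comp L V K
  have := Algebra.FormallyUnramified.isSeparable L K
  have hint : IsIntegral L (algebraMap V K t) := Algebra.IsIntegral.isIntegral _
  exact ht.not_isUnit <|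
    ((isIntegral_algebraMap_iff (IsFractionRing.injective V K)).mp hint).isUnit ht.ne_zero

/-- A discrete valuation ring essentially of finite type over a field of characteristic zero has
a derivation sending a given uniformizer to `1`. -/
theorem IsDiscreteValuationRing.exists_derivation_eq_one (k : Type*) {V : Type*} [Field k]
    [CharZero k] [CommRing V] [IsDomain V] [IsDiscreteValuationRing V] [Algebra k V]
    [Algebra.EssFiniteType k V] {t : V} (ht : Irreducible t) :
    ∃ d : Derivation k V V, d t = 1 := by
  obtain ⟨L, hL, hres⟩ := exists_subalgebra_isField_residueField_isAlgebraic k V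
  let : Field L := hL.toField
  have : CharZero L := charZero_of_injective_algebraMap (algebraMap k L).injective
  have : Algebra.EssFiniteType L V := .of_comp k L V
  have hspan := span_kaehlerDifferential_eq_top hres ht
  let e : V ≃ₗ[V] Ω[V⁄L] := LinearEquiv.ofBijective
    (LinearMap.toSpanSingleton V _ (KaehlerDifferential.D L V t)) <| by
    refine ⟨(injective_iff_map_eq_zero _).mpr fun r hr => ?_, ?_⟩
    · by_contra hr0
      exact smul_D_ne_zero ht hspan hr0 hr
    · rw [← LinearMap.range_eq_top, ← LinearMap.span_singleton_eq_range, hspan]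
  refine ⟨(e.symm.toLinearMap.compDer (KaehlerDifferential.D L V)).restrictScalars k, ?_⟩
  change e.symm (KaehlerDifferential.D L V t) = 1
  rw [LinearEquiv.symm_apply_eq]
  exact (one_smul V _).symm

/-- The largest ideal of `B` contained in the image of `R`. -/
def Algebra.conductorIdeal (R B : Type*) [CommRing R] [CommRing B] [Algebra R B] : Ideal B where
  carrier := {x | ∀ y, x * y ∈ (algebraMap R B).range}
  add_mem' hx hy z := by rw [add_mul]; exact add_mem (hx z) (hy z)
  zero_mem' z := by rw [zero_mul]; exact zero_mem _
  smul_mem' a x hx z := by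
    rw [smul_eq_mul, mul_comm a x, mul_assoc]
    exact hx _

theorem Algebra.mem_conductorIdeal {R B : Type*} [CommRing R] [CommRing B] [Algebra R B] {x : B} :
    x ∈ conductorIdeal R B ↔ ∀ y, x * y ∈ (algebraMap R B).range :=
  Iff.rfl

theorem Algebra.conductorIdeal_le_range {R B : Type*} [CommRing R] [CommRing B] [Algebra R B]
    {x : B} (hx : x ∈ conductorIdeal R B) : x ∈ (algebraMap R B).range := by
  simpa using hx 1

theorem Algebra.conductorIdeal_integralClosure_ne_bot {R K : Type*} [CommRing R] [IsDomain R]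
    [Field K] [Algebra R K] [IsFractionRing R K] [Module.Finite R (integralClosure R K)] :
    conductorIdeal R (integralClosure R K) ≠ ⊥ := by
  obtain ⟨s, hs⟩ := Module.Finite.fg_top (R := R) (M := integralClosure R K)
  obtain ⟨m, hm⟩ := IsLocalization.exist_integer_multiples (nonZeroDivisors R) s
    ((↑) : integralClosure R K → K)
  refine (Submodule.ne_bot_iff _).mpr ⟨algebraMap R _ m, fun y => ?_, ?_⟩
  · have hy : y ∈ Submodule.span R (s : Set (integralClosure R K)) := hs ▸ Submodule.mem_top
    rw [← Algebra.smul_def]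
    induction hy using Submodule.span_induction with
    | mem x hx =>
      obtain ⟨r, hr⟩ := hm x hx
      exact ⟨r, Subtype.ext hr⟩
    | zero => exact ⟨0, by simp⟩
    | add x y _ _ hx hy => rw [smul_add]; exact add_mem hx hy
    | smul a x _ hx =>
      obtain ⟨r, hr⟩ := hx
      exact ⟨a * r, by rw [smul_comm, ← hr, map_mul, Algebra.smul_def]⟩
  · exact (map_ne_zero_iff _ (FaithfulSMul.algebraMap_injective R _)).mpr
      (nonZeroDivisors.ne_zero m.2)

/-- A fraction multiplying the conductor into the base ring is integral. -/
theorem Algebra.exists_mul_eq_of_mul_mem_conductorIdeal {R K : Type*} [CommRing R] [IsDomain R]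
    [IsNoetherianRing R] [Field K] [Algebra R K] [IsFractionRing R K] {x₀ : integralClosure R K}
    (hx₀ : x₀ ∈ conductorIdeal R (integralClosure R K)) (h0 : x₀ ≠ 0) (g : R)
    (h : ∀ x ∈ conductorIdeal R (integralClosure R K), ∃ r : R,
      x₀ * algebraMap R _ r = x * algebraMap R _ g) :
    ∃ a, x₀ * a = algebraMap R (integralClosure R K) g := by
  have h0' : (x₀ : K) ≠ 0 := by simpa using h0
  let a : K := algebraMap R K g / x₀
  have hmul (x) (hx : x ∈ conductorIdeal R (integralClosure R K)) : ∃ y ∈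
      conductorIdeal R (integralClosure R K), (y : K) = x * a := by
    have key (z) (hz : z ∈ conductorIdeal R (integralClosure R K)) :
        ∃ r, algebraMap R K r = z * a := by
      obtain ⟨r, hr⟩ := h z hz
      refine ⟨r, ?_⟩
      have := congrArg (Subtype.val) hr
      simp only [MulMemClass.coe_mul, Subalgebra.coe_algebraMap] at this
      rw [mul_div_assoc', ← this, mul_div_cancel_left₀ _ h0']
    obtain ⟨r, hr⟩ := key x hx
    refine ⟨algebraMap R _ r, fun y => ?_, hr⟩
    obtain ⟨r', hr'⟩ := key (x * y) (Ideal.mul_mem_right y _ hx)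
    refine ⟨r', Subtype.ext ?_⟩
    simp only [MulMemClass.coe_mul, Subalgebra.coe_algebraMap] at hr' ⊢
    rw [hr, hr']
    ring
  have hpow (n : ℕ) : ∃ y ∈ conductorIdeal R (integralClosure R K), (y : K) = x₀ * a ^ n := by
    induction n with
    | zero => exact ⟨x₀, hx₀, by simp⟩
    | succ n ih =>
      obtain ⟨y, hy, hya⟩ := ih
      obtain ⟨z, hz, hza⟩ := hmul y hy
      exact ⟨z, hz, by rw [hza, hya, pow_succ, mul_assoc]⟩
  obtain ⟨r₀, rfl⟩ := conductorIdeal_le_range hx₀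
  have ha : IsIntegral R a := by
    refine IsAlmostIntegral.isIntegral ⟨r₀, mem_nonZeroDivisors_of_ne_zero ?_, fun n => ?_⟩
    · rintro rfl
      simp at h0
    · obtain ⟨y, hy, hya⟩ := hpow n
      obtain ⟨r, rfl⟩ := conductorIdeal_le_range hy
      exact ⟨r, hya.trans (Algebra.smul_def _ _).symm⟩
  exact ⟨⟨a, ha⟩, Subtype.ext (mul_div_cancel₀ _ h0')⟩

theorem Derivation.algebraMap_mem_conductorIdeal {k R K : Type*} [Field k] [CharZero k] [CommRing R]
    [IsDomain R] [IsNoetherianRing R] [Algebra k R] [Field K] [Algebra R K] [IsFractionRing R K]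
    [Algebra k K] [IsScalarTower k R K] (D : Derivation k R R) {z : R}
    (hz : algebraMap R _ z ∈ Algebra.conductorIdeal R (integralClosure R K)) :
    algebraMap R _ (D z) ∈ Algebra.conductorIdeal R (integralClosure R K) := by
  intro y
  obtain ⟨D', hD'⟩ := ((Algebra.linearMap R K).compDer D).exists_extension_of_isLocalization
    (T := K) (nonZeroDivisors R)
  replace hD' (r : R) : D' (algebraMap R K r) = algebraMap R K (D r) := hD' r
  have hy : IsIntegral R (D' y) := D'.map_mem_integralClosure (fun x => ⟨_, (hD' x).symm⟩) y.2
  obtain ⟨w, hw⟩ := hz y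
  obtain ⟨v, hv⟩ := hz ⟨_, hy⟩
  refine ⟨D w - v, Subtype.ext ?_⟩
  have hw' := congrArg Subtype.val hw
  have hv' := congrArg Subtype.val hv
  simp only [MulMemClass.coe_mul, Subalgebra.coe_algebraMap] at hw' hv' ⊢
  rw [map_sub, hv', ← hD', hw', D'.leibniz, hD']
  simp only [smul_eq_mul]
  ring

theorem Derivation.exists_algebraMap_comp_eq {k R B : Type*} [CommRing k] [CommRing R] [CommRing B]
    [Algebra k R] [Algebra k B] [Algebra R B] [IsScalarTower k R B] [FaithfulSMul R B]
    (d : Derivation k R B) (hd : ∀ r, d r ∈ (algebraMap R B).range) :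
    ∃ D : Derivation k R R, ∀ r, algebraMap R B (D r) = d r := by
  choose g hg using hd
  have hinj := FaithfulSMul.algebraMap_injective R B
  refine ⟨Derivation.mk' ⟨⟨g, fun x y => hinj ?_⟩, fun c x => hinj ?_⟩ fun x y => hinj ?_, hg⟩
  · simp [hg]
  · simp [hg, Algebra.smul_def, ← IsScalarTower.algebraMap_apply]
  · simp [hg, Algebra.smul_def]

/-- If `Der_k(R)` is free, derivations of the normalization of `R` preserve the conductor. -/
theorem Derivation.map_mem_conductorIdeal_of_free {k R K : Type*} [Field k] [CharZero k]
    [CommRing R] [IsDomain R] [IsNoetherianRing R] [Algebra k R] [Field K] [Algebra R K]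
    [IsFractionRing R K] [Algebra k K] [IsScalarTower k R K]
    [Module.Free R (Derivation k R R)]
    (F : Derivation k (integralClosure R K) (integralClosure R K)) {z : integralClosure R K}
    (hz : z ∈ Algebra.conductorIdeal R (integralClosure R K)) :
    F z ∈ Algebra.conductorIdeal R (integralClosure R K) := by
  let B := integralClosure R K
  have hinj := FaithfulSMul.algebraMap_injective R B
  by_cases h0 : z = 0
  · simp [h0]
  have hG (x : B) (hx : x ∈ Algebra.conductorIdeal R B) : ∃ D : Derivation k R R, ∀ r,
      algebraMap R B (D r) = x * F (algebraMap R B r) :=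
    (x • F.compAlgebraMap R).exists_algebraMap_comp_eq fun r => hx _
  obtain ⟨G, hGz⟩ := hG z hz
  let b := Module.Free.chooseBasis R (Derivation k R R)
  have hcoeff (i) : ∃ a, z * a = algebraMap R B (b.repr G i) := by
    refine Algebra.exists_mul_eq_of_mul_mem_conductorIdeal hz h0 _ fun x hx => ?_
    obtain ⟨D, hD⟩ := hG x hx
    obtain ⟨r, rfl⟩ := Algebra.conductorIdeal_le_range hx
    obtain ⟨s, rfl⟩ := Algebra.conductorIdeal_le_range hz
    have hsr : s • D = r • G := by
      ext y
      apply hinj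
      simp only [Derivation.smul_apply, smul_eq_mul, map_mul, hD, hGz]
      ring
    refine ⟨b.repr D i, ?_⟩
    rw [← map_mul, ← map_mul]
    simpa using congr(algebraMap R B (b.repr $hsr i))
  choose a ha using hcoeff
  obtain ⟨s, rfl⟩ := Algebra.conductorIdeal_le_range hz
  have hGs : G s = ∑ i ∈ (b.repr G).support, b.repr G i * b i s := by
    conv_lhs => rw [← b.linearCombination_repr G, Finsupp.linearCombination_apply, Finsupp.sum]
    exact map_sum ((Pi.evalAddMonoidHom _ s).comp Derivation.coeFnAddMonoidHom) _ _
  have hF : F (algebraMap R B s) =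
      ∑ i ∈ (b.repr G).support, a i * algebraMap R B (b i s) := by
    apply mul_left_cancel₀ h0
    rw [← hGz, hGs, map_sum, Finset.mul_sum]
    exact Finset.sum_congr rfl fun i _ => by rw [map_mul, ← ha, mul_assoc]
  rw [hF]
  exact sum_mem fun i _ => Ideal.mul_mem_left _ _ ((b i).algebraMap_mem_conductorIdeal hz)

/-- In characteristic zero, a Dedekind domain essentially of finite type over a field has no
nontrivial ideals stable under all derivations. -/
theorem IsDedekindDomain.eq_top_of_forall_derivation_mem (k : Type*) {B : Type*} [Field k]
    [CharZero k] [CommRing B] [IsDedekindDomain B] [Algebra k B] [Algebra.EssFiniteType k B]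
    {c : Ideal B} (hc : c ≠ ⊥) (h : ∀ F : Derivation k B B, ∀ z ∈ c, F z ∈ c) : c = ⊤ := by
  by_contra hctop
  obtain ⟨P, hP, hcP⟩ := Ideal.exists_le_maximal c hctop
  let V := Localization.AtPrime P
  have : IsDiscreteValuationRing V :=
    IsLocalization.AtPrime.isDiscreteValuationRing_of_dedekind_domain B
      (ne_bot_of_le_ne_bot hc hcP) V
  have : Algebra.EssFiniteType B V := .of_isLocalization V P.primeCompl
  have : Algebra.EssFiniteType k V := .comp k B V
  obtain ⟨t, ht⟩ := IsDiscreteValuationRing.exists_irreducible V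
  obtain ⟨d, hd⟩ := IsDiscreteValuationRing.exists_derivation_eq_one k ht
  have hBV : Function.Injective (algebraMap B V) :=
    IsLocalization.injective V P.primeCompl_le_nonZeroDivisors
  obtain ⟨n, hn⟩ := IsDiscreteValuationRing.ideal_eq_span_pow_irreducible
    ((Ideal.map_eq_bot_iff_of_injective hBV).not.mpr hc) ht
  have hmem {x : B} (hx : x ∈ c) : t ^ n ∣ algebraMap B V x :=
    Ideal.mem_span_singleton.mp (hn ▸ Ideal.mem_map_of_mem _ hx)
  obtain ⟨⟨⟨x, hx⟩, m⟩, hm⟩ := (IsLocalization.mem_map_algebraMap_iff P.primeCompl V).mp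
    (hn ▸ Ideal.mem_span_singleton_self _ : t ^ n ∈ c.map (algebraMap B V))
  obtain ⟨n, rfl⟩ := Nat.exists_eq_add_one_of_ne_zero (n := n) <| by
    rintro rfl
    have : algebraMap B V x ∈ maximalIdeal V :=
      (IsLocalization.AtPrime.to_map_mem_maximal_iff V P x).mpr (hcP hx)
    rw [← hm, pow_zero, one_mul] at this
    exact this (IsLocalization.map_units V m)
  have : Module.FinitePresentation B (Ω[B⁄k]) := Module.finitePresentation_of_finite B _
  obtain ⟨f, s, hfs⟩ := Module.FinitePresentation.exists_lift_of_isLocalizedModule P.primeCompl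
    (Algebra.linearMap B V) (d.compAlgebraMap B).liftKaehlerDifferential
  have hfx := LinearMap.congr_fun hfs (KaehlerDifferential.D k B x)
  have hdvd := hmem (h (f.compDer (KaehlerDifferential.D k B)) x hx)
  have hs : IsUnit (algebraMap B V s) := IsLocalization.map_units V s
  replace hfx : algebraMap B V (f (KaehlerDifferential.D k B x)) =
      algebraMap B V s * d (algebraMap B V x) := by
    simpa [Submonoid.smul_def, Algebra.smul_def] using hfx
  replace hdvd : t ^ (n + 1) ∣ algebraMap B V (f (KaehlerDifferential.D k B x)) := hdvd
  replace hm : t ^ (n + 1) * algebraMap B V m = algebraMap B V x := hm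
  rw [hfx, hs.dvd_mul_left, ← hm, d.leibniz, d.leibniz_pow, hd,
    Nat.add_sub_cancel, smul_eq_mul, dvd_add_right (dvd_mul_right _ _), smul_eq_mul,
    (IsLocalization.map_units V m).dvd_mul_left, nsmul_eq_mul] at hdvd
  have hn' : IsUnit ((n + 1 : ℕ) : V) := by
    rw [← _root_.map_natCast (algebraMap k V)]
    exact (Nat.cast_ne_zero.mpr n.succ_ne_zero).isUnit.map _
  rw [hn'.dvd_mul_left, smul_eq_mul, mul_one] at hdvd
  exact (pow_dvd_pow_iff ht.ne_zero ht.not_isUnit).not.mpr (by omega) hdvd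

/-- A one-dimensional local domain essentially of finite type over a field of characteristic zero
is a discrete valuation ring as soon as its module of derivations is free. -/
theorem IsDiscreteValuationRing.of_free_derivation (k R : Type*) [Field k] [CharZero k] [CommRing R]
    [IsDomain R] [IsNoetherianRing R] [IsLocalRing R] [Algebra k R] [Algebra.EssFiniteType k R]
    (hdim : ringKrullDim R = 1) [Module.Free R (Derivation k R R)] :
    IsDiscreteValuationRing R := by
  let K := FractionRing R
  let B := integralClosure R K
  have hfin : Module.Finite R B := .integralClosure_of_essFiniteType k
  have : Algebra.EssFiniteType k B := .comp k R B
  have hR : ¬ IsField R := fun h => by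
    simp [ringKrullDim_eq_zero_of_isField h] at hdim
  have : Ring.DimensionLEOne R := ⟨fun {P} hP hP' =>
    Ring.krullDimLE_one_iff_of_noZeroDivisors.mp (Ring.krullDimLE_iff.mpr hdim.le) P hP hP'⟩
  have : IsIntegrallyClosed B := integralClosure.isIntegrallyClosedOfFiniteExtension K
  have : IsNoetherianRing B := .of_finite R B
  have : IsDedekindDomain B := { }
  have htop : Algebra.conductorIdeal R B = ⊤ :=
    IsDedekindDomain.eq_top_of_forall_derivation_mem k
      Algebra.conductorIdeal_integralClosure_ne_bot
      fun F _ hz => F.map_mem_conductorIdeal_of_free hz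
  have : IsIntegrallyClosed R := (isIntegrallyClosed_iff K).mpr fun {x} hx => by
    obtain ⟨y, hy⟩ := Algebra.conductorIdeal_le_range
      (htop ▸ Submodule.mem_top : (⟨x, hx⟩ : B) ∈ Algebra.conductorIdeal R B)
    exact ⟨y, congrArg Subtype.val hy⟩
  have : IsDedekindDomain R := { }
  exact ((IsDiscreteValuationRing.TFAE R hR).out 2 0).mp this

/-- Let R be a one-dimensional Noetherian local domain, essentially of
finite type over a field k of characteristic zero.  If Der_k(R) is a free R-module,
then R is regular.  (The one-dimensional Zariski–Lipman conjecture.) -/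
theorem stmt_14 (k R : Type*) [Field k] [CharZero k] [CommRing R] [IsDomain R]
    [IsNoetherianRing R] [IsLocalRing R] [Algebra k R] [Algebra.EssFiniteType k R]
    (hdim : ringKrullDim R = 1)
    (hfree : Module.Free R (Derivation k R R)) :
    IsRegularLocal R := by
  have := IsDiscreteValuationRing.of_free_derivation k R hdim
  change ((Module.finrank (ResidueField R) (CotangentSpace R) : ℕ) : WithBot (WithTop ℕ)) = _
  rw [hdim, finrank_CotangentSpace_eq_one]
  rfl
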